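/- Under the structure conditions, the angle map f ↦ (θ_i, θ_j, θ_k) is smooth on the admissible space Ω^E_{ijk}, and at every point of Ω^E_{ijk} its 3×3 Jacobian matrix Λ^E_{ijk} := ( ∂θ_a/∂u_b )_{a,b ∈ {i,j,k}} (with u = f) is symmetric and negative semidefinite, with kernel exactly {c(1,1,1)ᵀ : c ∈ ℝ}; in particular Λ^E_{ijk} has rank 2. -/

import Mathlib

open Real

/-- Euclidean discrete conformal edge length between vertices `s` and `t` of the triangle,
for scheme coefficients `ε`, conformal structure coefficients `η` and conformal factors `f`. -/
noncomputable def lE (ε : Fin 3 → ℝ) (η : Fin 3 → Fin 3 → ℝ) (f : Fin 3 → ℝ)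
    (s t : Fin 3) : ℝ :=
  Real.sqrt (ε s * exp (2 * f s) + ε t * exp (2 * f t) + 2 * η s t * exp (f s + f t))

/-- The admissible space `Ω^E_{ijk}`: conformal factors for which the three edge lengths
satisfy the three strict triangle inequalities. -/
def OmegaE (ε : Fin 3 → ℝ) (η : Fin 3 → Fin 3 → ℝ) : Set (Fin 3 → ℝ) :=
  {f | ∀ s t r : Fin 3, s ≠ t → s ≠ r → t ≠ r →
    lE ε η f s t + lE ε η f s r > lE ε η f t r}

/-- The inner angle at the vertex `a` of the Euclidean triangle, via the law of cosines.
The two other vertices of the triangle are `a + 1` and `a + 2` (cyclically in `Fin 3`). -/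
noncomputable def thetaE (ε : Fin 3 → ℝ) (η : Fin 3 → Fin 3 → ℝ) (f : Fin 3 → ℝ)
    (a : Fin 3) : ℝ :=
  arccos ((lE ε η f a (a + 1) ^ 2 + lE ε η f a (a + 2) ^ 2 - lE ε η f (a + 1) (a + 2) ^ 2) /
    (2 * lE ε η f a (a + 1) * lE ε η f a (a + 2)))

/-- The structure conditions on the weights of the triangle. -/
def StructCondE (ε : Fin 3 → ℝ) (η : Fin 3 → Fin 3 → ℝ) : Prop :=
  (∀ s, ε s = 0 ∨ ε s = 1) ∧ (∀ s t, η s t = η t s) ∧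
  (∀ s t : Fin 3, s ≠ t → ε s * ε t + η s t > 0) ∧
  (∀ q s t : Fin 3, q ≠ s → q ≠ t → s ≠ t → ε q * η s t + η q s * η q t ≥ 0)

/-- The Jacobian matrix `Λ^E_{ijk} = (∂θ_a/∂u_b)` of the angle map at the point `f`
(in the Euclidean background the coordinate `u` equals `f`). -/
noncomputable def JacE (ε : Fin 3 → ℝ) (η : Fin 3 → Fin 3 → ℝ) (f : Fin 3 → ℝ)
    (a b : Fin 3) : ℝ :=
  fderiv ℝ (fun g => thetaE ε η g a) f (Pi.single b 1)

/-- The squared edge length `l_st²` as an exponential polynomial in the conformal factors. -/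
noncomputable def sqLen (ε : Fin 3 → ℝ) (η : Fin 3 → Fin 3 → ℝ) (f : Fin 3 → ℝ)
    (s t : Fin 3) : ℝ :=
  ε s * exp (2 * f s) + ε t * exp (2 * f t) + 2 * η s t * exp (f s + f t)

/-- Sixteen times the squared area of a triangle with side lengths `p`, `q`, `r`. -/
def heron (p q r : ℝ) : ℝ := 4 * p ^ 2 * q ^ 2 - (p ^ 2 + q ^ 2 - r ^ 2) ^ 2

/-- The numerator of the conductance of an edge with data `(e₁, x₁)`, `(e₂, x₂)` at its ends, where
`n₁₂`, `n₁₃`, `n₂₃` are the edge weights and `x₃` is the radius at the opposite vertex. -/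
def condNum (e₁ e₂ n₁₂ n₁₃ n₂₃ x₁ x₂ x₃ : ℝ) : ℝ :=
  (e₁ * e₂ - n₁₂ ^ 2) * (x₁ * x₂) + (e₁ * n₂₃ + n₁₂ * n₁₃) * (x₁ * x₃)
    + (e₂ * n₁₃ + n₁₂ * n₂₃) * (x₂ * x₃)

/-- The conductance `∂θ_a/∂u_b` of the edge `ab` in the triangle `abc`. -/
noncomputable def conductance (ε : Fin 3 → ℝ) (η : Fin 3 → Fin 3 → ℝ) (f : Fin 3 → ℝ)
    (a b c : Fin 3) : ℝ :=
  2 * (exp (f a) * exp (f b) * condNum (ε a) (ε b) (η a b) (η a c) (η b c)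
    (exp (f a)) (exp (f b)) (exp (f c))) /
    (sqLen ε η f a b * √(heron (lE ε η f a b) (lE ε η f a c) (lE ε η f b c)))

lemma heron_pos {p q r : ℝ} (h₁ : r < p + q) (h₂ : q < p + r) (h₃ : p < q + r) :
    0 < heron p q r := by
  have : heron p q r = (p + q + r) * (p + q - r) * ((p + r - q) * (q + r - p)) := by
    unfold heron; ring
  rw [this]
  have h₄ : 0 < p + q + r := by linarith
  have h₅ : 0 < p + q - r := by linarith
  have h₆ : 0 < p + r - q := by linarith
  have h₇ : 0 < q + r - p := by linarith
  positivity

lemma cosine_sq {p q : ℝ} (r : ℝ) (hp : 0 < p) (hq : 0 < q) :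
    1 - ((p ^ 2 + q ^ 2 - r ^ 2) / (2 * p * q)) ^ 2 = heron p q r / (2 * p * q) ^ 2 := by
  unfold heron; field_simp; ring

lemma cosine_ne {p q r : ℝ} (hp : 0 < p) (hq : 0 < q) (hD : 0 < heron p q r) :
    (p ^ 2 + q ^ 2 - r ^ 2) / (2 * p * q) ≠ -1 ∧ (p ^ 2 + q ^ 2 - r ^ 2) / (2 * p * q) ≠ 1 := by
  have h := cosine_sq r hp hq
  have h' : 0 < heron p q r / (2 * p * q) ^ 2 := by positivity
  constructor <;> intro hu <;> rw [hu] at h <;> norm_num at h <;> linarith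

lemma hasDerivAt_angle {p q r : ℝ → ℝ} {p' q' r' t : ℝ} (hp : HasDerivAt p p' t)
    (hq : HasDerivAt q q' t) (hr : HasDerivAt r r' t) (p0 : 0 < p t) (q0 : 0 < q t)
    (hD : 0 < heron (p t) (q t) (r t)) :
    HasDerivAt (fun s => arccos ((p s ^ 2 + q s ^ 2 - r s ^ 2) / (2 * p s * q s)))
      ((2 * r t * r' - (r t ^ 2 + p t ^ 2 - q t ^ 2) / p t * p'
        - (r t ^ 2 + q t ^ 2 - p t ^ 2) / q t * q') / √(heron (p t) (q t) (r t))) t := by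
  obtain ⟨h₁, h₂⟩ := cosine_ne p0 q0 hD
  have hu := (((hp.pow 2).add (hq.pow 2)).sub (hr.pow 2)).div ((hp.const_mul 2).mul hq)
    (by simp only [Pi.mul_apply]; positivity)
  have h := (hasDerivAt_arccos h₁ h₂).comp t hu
  refine h.congr_deriv ?_
  have hs : √(heron (p t) (q t) (r t)) ≠ 0 := (sqrt_pos.2 hD).ne'
  rw [cosine_sq _ p0 q0, sqrt_div hD.le, sqrt_sq (by positivity)]
  simp only [Pi.mul_apply, Pi.add_apply, Pi.sub_apply, Pi.pow_apply]
  field_simp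
  ring

lemma four_mul_sum_condNum (e₁ e₂ e₃ n₁₂ n₁₃ n₂₃ x y z : ℝ) :
    4 * (x * y * condNum e₁ e₂ n₁₂ n₁₃ n₂₃ x y z + x * z * condNum e₁ e₃ n₁₃ n₁₂ n₂₃ x z y
      + y * z * condNum e₂ e₃ n₂₃ n₁₂ n₁₃ y z x) =
    4 * (e₁ * x ^ 2 + e₂ * y ^ 2 + 2 * n₁₂ * (x * y))
        * (e₁ * x ^ 2 + e₃ * z ^ 2 + 2 * n₁₃ * (x * z))
      - ((e₁ * x ^ 2 + e₂ * y ^ 2 + 2 * n₁₂ * (x * y))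
        + (e₁ * x ^ 2 + e₃ * z ^ 2 + 2 * n₁₃ * (x * z))
        - (e₂ * y ^ 2 + e₃ * z ^ 2 + 2 * n₂₃ * (y * z))) ^ 2 := by
  unfold condNum; ring

lemma sum_condNum_mul_condNum (e₁ e₂ e₃ n₁₂ n₁₃ n₂₃ x y z : ℝ) :
    x * condNum e₁ e₂ n₁₂ n₁₃ n₂₃ x y z * condNum e₁ e₃ n₁₃ n₁₂ n₂₃ x z y
        * (e₂ * y ^ 2 + e₃ * z ^ 2 + 2 * n₂₃ * (y * z))
      + y * condNum e₁ e₂ n₁₂ n₁₃ n₂₃ x y z * condNum e₂ e₃ n₂₃ n₁₂ n₁₃ y z x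
        * (e₁ * x ^ 2 + e₃ * z ^ 2 + 2 * n₁₃ * (x * z))
      + z * condNum e₁ e₃ n₁₃ n₁₂ n₂₃ x z y * condNum e₂ e₃ n₂₃ n₁₂ n₁₃ y z x
        * (e₁ * x ^ 2 + e₂ * y ^ 2 + 2 * n₁₂ * (x * y)) =
    (x * y * condNum e₁ e₂ n₁₂ n₁₃ n₂₃ x y z + x * z * condNum e₁ e₃ n₁₃ n₁₂ n₂₃ x z y
      + y * z * condNum e₂ e₃ n₂₃ n₁₂ n₁₃ y z x) *
    (2 * (e₁ * e₂ * e₃ + n₁₂ * n₁₃ * n₂₃) * (x * y * z)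
      + (e₁ * n₂₃ + n₁₂ * n₁₃) * x * (e₂ * y ^ 2 + e₃ * z ^ 2)
      + (e₂ * n₁₃ + n₁₂ * n₂₃) * y * (e₁ * x ^ 2 + e₃ * z ^ 2)
      + (e₃ * n₁₂ + n₁₃ * n₂₃) * z * (e₁ * x ^ 2 + e₂ * y ^ 2)) := by
  unfold condNum; ring

lemma two_mul_le_weighted {e e' : ℝ} (he : e = 0 ∨ e = 1) (he' : e' = 0 ∨ e' = 1) (x y : ℝ) :
    2 * (e * e') * (x * y) ≤ e * x ^ 2 + e' * y ^ 2 := by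
  rcases he with rfl | rfl <;> rcases he' with rfl | rfl <;>
    nlinarith [sq_nonneg (x - y), sq_nonneg x, sq_nonneg y]

lemma structure_form_pos {e₁ e₂ e₃ n₁₂ n₁₃ n₂₃ x y z : ℝ} (h₁ : e₁ = 0 ∨ e₁ = 1)
    (h₂ : e₂ = 0 ∨ e₂ = 1) (h₃ : e₃ = 0 ∨ e₃ = 1) (h₁₂ : 0 < e₁ * e₂ + n₁₂)
    (h₁₃ : 0 < e₁ * e₃ + n₁₃) (h₂₃ : 0 < e₂ * e₃ + n₂₃) (g₁ : 0 ≤ e₁ * n₂₃ + n₁₂ * n₁₃)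
    (g₂ : 0 ≤ e₂ * n₁₃ + n₁₂ * n₂₃) (g₃ : 0 ≤ e₃ * n₁₂ + n₁₃ * n₂₃)
    (hx : 0 < x) (hy : 0 < y) (hz : 0 < z) :
    0 < 2 * (e₁ * e₂ * e₃ + n₁₂ * n₁₃ * n₂₃) * (x * y * z)
      + (e₁ * n₂₃ + n₁₂ * n₁₃) * x * (e₂ * y ^ 2 + e₃ * z ^ 2)
      + (e₂ * n₁₃ + n₁₂ * n₂₃) * y * (e₁ * x ^ 2 + e₃ * z ^ 2)
      + (e₃ * n₁₂ + n₁₃ * n₂₃) * z * (e₁ * x ^ 2 + e₂ * y ^ 2) := by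
  have k₁ := mul_le_mul_of_nonneg_left (two_mul_le_weighted h₂ h₃ y z) (mul_nonneg g₁ hx.le)
  have k₂ := mul_le_mul_of_nonneg_left (two_mul_le_weighted h₁ h₃ x z) (mul_nonneg g₂ hy.le)
  have k₃ := mul_le_mul_of_nonneg_left (two_mul_le_weighted h₁ h₂ x y) (mul_nonneg g₃ hz.le)
  have idem : ∀ {e : ℝ}, e = 0 ∨ e = 1 → e ^ 2 = e := by rintro e (rfl | rfl) <;> norm_num
  have hprod : (e₁ * e₂ + n₁₂) * (e₁ * e₃ + n₁₃) * (e₂ * e₃ + n₂₃) =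
      e₁ * e₂ * e₃ + n₁₂ * n₁₃ * n₂₃ + (e₁ * n₂₃ + n₁₂ * n₁₃) * (e₂ * e₃)
        + (e₂ * n₁₃ + n₁₂ * n₂₃) * (e₁ * e₃) + (e₃ * n₁₂ + n₁₃ * n₂₃) * (e₁ * e₂) := by
    ring_nf
    rw [idem h₁, idem h₂, idem h₃]
    ring
  have hpos : 0 < 2 * ((e₁ * e₂ + n₁₂) * (e₁ * e₃ + n₁₃) * (e₂ * e₃ + n₂₃)) * (x * y * z) := by
    positivity
  rw [hprod] at hpos
  linarith

lemma lt_of_lt_sq_of_add_pos {e n : ℝ} (he : e = 0 ∨ e = 1) (h : 0 < e + n) (h' : e < n ^ 2) :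
    e < n := by
  rcases he with rfl | rfl <;> nlinarith

lemma minor_le {e₁ e₂ e₃ n₁₂ n₁₃ n₂₃ : ℝ} (h₁ : e₁ = 0 ∨ e₁ = 1)
    (h₂ : e₂ = 0 ∨ e₂ = 1) (h₃ : e₃ = 0 ∨ e₃ = 1) (h₁₂ : 0 < e₁ * e₂ + n₁₂)
    (h₁₃ : 0 < e₁ * e₃ + n₁₃) (h₂₃ : 0 < e₂ * e₃ + n₂₃)
    (hA : 0 < n₂₃ ^ 2 - e₂ * e₃) (hB : 0 < n₁₃ ^ 2 - e₁ * e₃) :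
    (n₂₃ ^ 2 - e₂ * e₃) * (n₁₃ ^ 2 - e₁ * e₃) ≤ (e₃ * n₁₂ + n₁₃ * n₂₃) ^ 2 := by
  rcases h₃ with rfl | rfl
  · apply le_of_eq; ring
  simp only [mul_one, one_mul] at *
  have ha := lt_of_lt_sq_of_add_pos h₂ h₂₃ (by linarith)
  have hb := lt_of_lt_sq_of_add_pos h₁ h₁₃ (by linarith)
  have h0 : e₁ * e₂ ≤ n₁₃ * n₂₃ :=
    mul_le_mul hb.le ha.le (by rcases h₂ with rfl | rfl <;> norm_num)
      (by rcases h₁ with rfl | rfl <;> linarith)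
  have h1 : (n₁₃ * n₂₃ - e₁ * e₂) ^ 2 ≤ (n₁₂ + n₁₃ * n₂₃) ^ 2 :=
    pow_le_pow_left₀ (by linarith) (by linarith) 2
  refine le_trans ?_ h1
  rcases h₁ with rfl | rfl <;> rcases h₂ with rfl | rfl <;>
    nlinarith [sq_nonneg (n₁₃ - n₂₃), sq_nonneg n₁₃, sq_nonneg n₂₃]

lemma condNum_nonneg_or {e₁ e₂ e₃ n₁₂ n₁₃ n₂₃ x y z : ℝ} (h₁ : e₁ = 0 ∨ e₁ = 1)
    (h₂ : e₂ = 0 ∨ e₂ = 1) (h₃ : e₃ = 0 ∨ e₃ = 1) (h₁₂ : 0 < e₁ * e₂ + n₁₂)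
    (h₁₃ : 0 < e₁ * e₃ + n₁₃) (h₂₃ : 0 < e₂ * e₃ + n₂₃) (g₁ : 0 ≤ e₁ * n₂₃ + n₁₂ * n₁₃)
    (g₂ : 0 ≤ e₂ * n₁₃ + n₁₂ * n₂₃) (g₃ : 0 ≤ e₃ * n₁₂ + n₁₃ * n₂₃)
    (hx : 0 < x) (hy : 0 < y) (hz : 0 < z) :
    0 ≤ condNum e₁ e₃ n₁₃ n₁₂ n₂₃ x z y ∨ 0 ≤ condNum e₂ e₃ n₂₃ n₁₂ n₁₃ y z x := by
  by_contra! h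
  obtain ⟨hb, ha⟩ := h
  unfold condNum at ha hb
  have hA : (e₃ * n₁₂ + n₁₃ * n₂₃) * x < (n₂₃ ^ 2 - e₂ * e₃) * y := by
    have := mul_nonneg g₂ (mul_pos hy hx).le
    exact lt_of_mul_lt_mul_right (by linarith) hz.le
  have hB : (e₃ * n₁₂ + n₁₃ * n₂₃) * y < (n₁₃ ^ 2 - e₁ * e₃) * x := by
    have := mul_nonneg g₁ (mul_pos hx hy).le
    exact lt_of_mul_lt_mul_right (by linarith) hz.le
  have hA' : 0 < n₂₃ ^ 2 - e₂ * e₃ :=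
    pos_of_mul_pos_left ((mul_nonneg g₃ hx.le).trans_lt hA) hy.le
  have hB' : 0 < n₁₃ ^ 2 - e₁ * e₃ :=
    pos_of_mul_pos_left ((mul_nonneg g₃ hy.le).trans_lt hB) hx.le
  have hlt := mul_lt_mul'' hA hB (mul_nonneg g₃ hx.le) (mul_nonneg g₃ hy.le)
  have hle := mul_le_mul_of_nonneg_right (minor_le h₁ h₂ h₃ h₁₂ h₁₃ h₂₃ hA' hB')
    (mul_pos hx hy).le
  linarith

lemma add_pos_of_pairwise_products {u v w : ℝ} (h : 0 < u * v + u * w + v * w) (huv : 0 ≤ u ∨ 0 ≤ v)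
    (huw : 0 ≤ u ∨ 0 ≤ w) (hvw : 0 ≤ v ∨ 0 ≤ w) : 0 < u + v := by
  by_contra! hs
  rcases lt_or_ge u 0 with hu | hu
  · have hv := huv.resolve_left hu.not_ge
    have hw := huw.resolve_left hu.not_ge
    nlinarith [mul_nonneg (neg_nonneg.2 hu.le) hv, mul_nonneg hw (neg_nonneg.2 hs)]
  · rcases lt_or_ge v 0 with hv | hv
    · have hw := hvw.resolve_left hv.not_ge
      nlinarith [mul_nonneg (neg_nonneg.2 hv.le) hu, mul_nonneg hw (neg_nonneg.2 hs)]
    · have hu0 : u = 0 := by linarith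
      have hv0 : v = 0 := by linarith
      simp [hu0, hv0] at h

lemma graph_form_nonneg_and_eq_zero {u v w : ℝ} (h : 0 < u * v + u * w + v * w) (huv : 0 < u + v)
    (a b c : ℝ) : 0 ≤ u * (a - b) ^ 2 + v * (a - c) ^ 2 + w * (b - c) ^ 2 ∧
      (u * (a - b) ^ 2 + v * (a - c) ^ 2 + w * (b - c) ^ 2 = 0 → a = c ∧ b = c) := by
  have key : (u + v) * (u * (a - b) ^ 2 + v * (a - c) ^ 2 + w * (b - c) ^ 2) =
      ((u + v) * (a - c) - u * (b - c)) ^ 2 + (u * v + u * w + v * w) * (b - c) ^ 2 := by ring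
  constructor
  · rw [← mul_nonneg_iff_of_pos_left huv, key]
    positivity
  · intro h0
    rw [h0, mul_zero] at key
    have h₁ : (u * v + u * w + v * w) * (b - c) ^ 2 = 0 := by
      nlinarith [sq_nonneg ((u + v) * (a - c) - u * (b - c)), mul_nonneg h.le (sq_nonneg (b - c))]
    have hbc : b - c = 0 := by simpa [h.ne'] using h₁
    rw [hbc] at key
    have hac : a - c = 0 := by simpa [huv.ne'] using key.symm
    constructor <;> linarith

section Triangle

variable {ε : Fin 3 → ℝ} {η : Fin 3 → Fin 3 → ℝ} {f : Fin 3 → ℝ}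

lemma lE_eq_sqrt (s t : Fin 3) : lE ε η f s t = √(sqLen ε η f s t) := rfl

lemma sqLen_eq (s t : Fin 3) : sqLen ε η f s t =
    ε s * exp (f s) ^ 2 + ε t * exp (f t) ^ 2 + 2 * η s t * (exp (f s) * exp (f t)) := by
  simp only [sqLen, exp_add, two_mul]; ring

lemma sqLen_comm (hη : ∀ s t, η s t = η t s) (s t : Fin 3) :
    sqLen ε η f s t = sqLen ε η f t s := by
  rw [sqLen_eq, sqLen_eq, hη s t]; ring

lemma lE_comm (hη : ∀ s t, η s t = η t s) (s t : Fin 3) : lE ε η f s t = lE ε η f t s := by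
  rw [lE_eq_sqrt, lE_eq_sqrt, sqLen_comm hη]

lemma lE_pos (hη : ∀ s t, η s t = η t s) (hf : f ∈ OmegaE ε η) {s t r : Fin 3}
    (hst : s ≠ t) (hsr : s ≠ r) (htr : t ≠ r) : 0 < lE ε η f s t := by
  have h₁ := hf s t r hst hsr htr
  have h₂ := hf t s r hst.symm htr hsr
  rw [lE_comm hη t s] at h₂
  linarith

lemma sqLen_pos (hη : ∀ s t, η s t = η t s) (hf : f ∈ OmegaE ε η) {s t r : Fin 3}
    (hst : s ≠ t) (hsr : s ≠ r) (htr : t ≠ r) : 0 < sqLen ε η f s t :=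
  sqrt_pos.1 (lE_pos hη hf hst hsr htr)

lemma lE_sq (hη : ∀ s t, η s t = η t s) (hf : f ∈ OmegaE ε η) {s t r : Fin 3}
    (hst : s ≠ t) (hsr : s ≠ r) (htr : t ≠ r) : lE ε η f s t ^ 2 = sqLen ε η f s t :=
  sq_sqrt (sqLen_pos hη hf hst hsr htr).le

lemma heron_lE_pos (hη : ∀ s t, η s t = η t s) (hf : f ∈ OmegaE ε η) {a b c : Fin 3}
    (hab : a ≠ b) (hac : a ≠ c) (hbc : b ≠ c) :
    0 < heron (lE ε η f a b) (lE ε η f a c) (lE ε η f b c) := by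
  have h₁ := hf a b c hab hac hbc
  have h₂ := hf b a c hab.symm hbc hac
  have h₃ := hf c a b hac.symm hbc.symm hab
  rw [lE_comm hη b a] at h₂
  rw [lE_comm hη c a, lE_comm hη c b] at h₃
  exact heron_pos h₁ h₂ h₃

lemma contDiff_sqLen (s t : Fin 3) :
    ContDiff ℝ (⊤ : ℕ∞) (fun g : Fin 3 → ℝ => sqLen ε η g s t) := by
  unfold sqLen; fun_prop

lemma contDiffAt_thetaE (hη : ∀ s t, η s t = η t s) (hf : f ∈ OmegaE ε η) (a : Fin 3) :
    ContDiffAt ℝ (⊤ : ℕ∞) (fun g : Fin 3 → ℝ => thetaE ε η g a) f := by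
  have hab : a ≠ a + 1 := by fin_cases a <;> decide
  have hac : a ≠ a + 2 := by fin_cases a <;> decide
  have hbc : a + 1 ≠ a + 2 := by fin_cases a <;> decide
  have hl : ∀ s t r : Fin 3, s ≠ t → s ≠ r → t ≠ r →
      ContDiffAt ℝ (⊤ : ℕ∞) (fun g : Fin 3 → ℝ => lE ε η g s t) f := fun s t r h₁ h₂ h₃ =>
    (contDiff_sqLen s t).contDiffAt.sqrt (sqLen_pos hη hf h₁ h₂ h₃).ne'
  have p0 := lE_pos hη hf hab hac hbc
  have q0 := lE_pos hη hf hac hab hbc.symm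
  obtain ⟨h₁, h₂⟩ := cosine_ne p0 q0 (heron_lE_pos hη hf hab hac hbc)
  have hp := hl _ _ _ hab hac hbc
  have hq := hl _ _ _ hac hab hbc.symm
  have hr := hl _ _ _ hbc hab.symm hac.symm
  exact (contDiffAt_arccos h₁ h₂).comp f
    ((((hp.pow 2).add (hq.pow 2)).sub (hr.pow 2)).div ((contDiffAt_const.mul hp).mul hq)
      (by positivity))

lemma hasDerivAt_sqLen (v : Fin 3 → ℝ) (s t : Fin 3) :
    HasDerivAt (fun y : ℝ => sqLen ε η (f + y • v) s t)
      (2 * (ε s * exp (f s) ^ 2 + η s t * (exp (f s) * exp (f t))) * v s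
        + 2 * (ε t * exp (f t) ^ 2 + η s t * (exp (f s) * exp (f t))) * v t) 0 := by
  have hl : ∀ s : Fin 3, HasDerivAt (fun y : ℝ => exp ((f + y • v) s)) (exp (f s) * v s) 0 := by
    intro s
    have h : HasDerivAt (fun y : ℝ => (f + y • v) s) (v s) 0 := by
      simpa using ((hasDerivAt_id (0 : ℝ)).mul_const (v s)).const_add (f s)
    simpa using h.exp
  simp only [sqLen_eq]
  have h := ((((hl s).pow 2).const_mul (ε s)).add (((hl t).pow 2).const_mul (ε t))).add
    (((hl s).mul (hl t)).const_mul (2 * η s t))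
  refine h.congr_deriv ?_
  simp
  ring

lemma hasDerivAt_lE (hη : ∀ s t, η s t = η t s) (hf : f ∈ OmegaE ε η) {s t r : Fin 3}
    (hst : s ≠ t) (hsr : s ≠ r) (htr : t ≠ r) (v : Fin 3 → ℝ) :
    HasDerivAt (fun y : ℝ => lE ε η (f + y • v) s t)
      (((ε s * exp (f s) ^ 2 + η s t * (exp (f s) * exp (f t))) * v s
        + (ε t * exp (f t) ^ 2 + η s t * (exp (f s) * exp (f t))) * v t) / lE ε η f s t) 0 := by
  have h := (hasDerivAt_sqLen (ε := ε) (η := η) (f := f) v s t).sqrt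
    (by simpa using (sqLen_pos hη hf hst hsr htr).ne')
  have h0 := lE_pos hη hf hst hsr htr
  refine h.congr_deriv ?_
  rw [zero_smul, add_zero, ← lE_eq_sqrt]
  field_simp

lemma heron_lE_swap (hη : ∀ s t, η s t = η t s) (a b c : Fin 3) :
    heron (lE ε η f a c) (lE ε η f a b) (lE ε η f c b)
      = heron (lE ε η f a b) (lE ε η f a c) (lE ε η f b c) := by
  rw [lE_comm hη c b]; unfold heron; ring

lemma heron_lE_rotate (hη : ∀ s t, η s t = η t s) (a b c : Fin 3) :
    heron (lE ε η f b c) (lE ε η f b a) (lE ε η f c a)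
      = heron (lE ε η f a b) (lE ε η f a c) (lE ε η f b c) := by
  rw [lE_comm hη b a, lE_comm hη c a]; unfold heron; ring

lemma hasDerivAt_angle_line (hη : ∀ s t, η s t = η t s) (hf : f ∈ OmegaE ε η) {a b c : Fin 3}
    (hab : a ≠ b) (hac : a ≠ c) (hbc : b ≠ c) (v : Fin 3 → ℝ) :
    HasDerivAt (fun y : ℝ => arccos ((lE ε η (f + y • v) a b ^ 2 + lE ε η (f + y • v) a c ^ 2
        - lE ε η (f + y • v) b c ^ 2) / (2 * lE ε η (f + y • v) a b * lE ε η (f + y • v) a c)))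
      (conductance ε η f a b c * (v b - v a) + conductance ε η f a c b * (v c - v a)) 0 := by
  have p0 := lE_pos hη hf hab hac hbc
  have q0 := lE_pos hη hf hac hab hbc.symm
  have r0 := lE_pos hη hf hbc hab.symm hac.symm
  have hD := heron_lE_pos hη hf hab hac hbc
  have h := hasDerivAt_angle (hasDerivAt_lE hη hf hab hac hbc v)
    (hasDerivAt_lE hη hf hac hab hbc.symm v) (hasDerivAt_lE hη hf hbc hab.symm hac.symm v)
    (by simpa using p0) (by simpa using q0) (by simpa using hD)
  refine h.congr_deriv ?_
  have hs : √(heron (lE ε η f a b) (lE ε η f a c) (lE ε η f b c)) ≠ 0 := (sqrt_pos.2 hD).ne'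
  simp only [zero_smul, add_zero, conductance, heron_lE_swap hη a b c, hη c b]
  generalize √(heron (lE ε η f a b) (lE ε η f a c) (lE ε η f b c)) = S at hs ⊢
  have P := lE_sq hη hf hab hac hbc
  have Q := lE_sq hη hf hac hab hbc.symm
  have R := lE_sq hη hf hbc hab.symm hac.symm
  rw [← P, ← Q]
  rw [sqLen_eq] at P Q R
  generalize lE ε η f a b = p at *
  generalize lE ε η f a c = q at *
  generalize lE ε η f b c = r at *
  generalize exp (f a) = x at *
  generalize exp (f b) = y at *
  generalize exp (f c) = z at *
  field_simp
  rw [P, Q, R]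
  unfold condNum
  ring

lemma conductance_comm (hη : ∀ s t, η s t = η t s) (a b c : Fin 3) :
    conductance ε η f a b c = conductance ε η f b a c := by
  have h : heron (lE ε η f b a) (lE ε η f b c) (lE ε η f a c)
      = heron (lE ε η f a b) (lE ε η f a c) (lE ε η f b c) := by
    rw [lE_comm hη b a]; unfold heron; ring
  unfold conductance
  rw [h, sqLen_comm hη b a, hη b a]
  congr 2
  unfold condNum
  ring

lemma fderiv_thetaE (hη : ∀ s t, η s t = η t s) (hf : f ∈ OmegaE ε η) (a : Fin 3)
    (v : Fin 3 → ℝ) : fderiv ℝ (fun g => thetaE ε η g a) f v =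
      conductance ε η f a (a + 1) (a + 2) * (v (a + 1) - v a)
        + conductance ε η f a (a + 2) (a + 1) * (v (a + 2) - v a) := by
  have hab : a ≠ a + 1 := by fin_cases a <;> decide
  have hac : a ≠ a + 2 := by fin_cases a <;> decide
  have hbc : a + 1 ≠ a + 2 := by fin_cases a <;> decide
  have hd := (contDiffAt_thetaE hη hf a).differentiableAt (by simp)
  rw [← hd.lineDeriv_eq_fderiv]
  exact (hasDerivAt_angle_line hη hf hab hac hbc v).deriv

lemma sum_JacE_mul (a : Fin 3) (v : Fin 3 → ℝ) :
    ∑ b, JacE ε η f a b * v b = fderiv ℝ (fun g => thetaE ε η g a) f v := by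
  conv_rhs => rw [pi_eq_sum_univ' v, map_sum]
  refine Finset.sum_congr rfl fun b _ => ?_
  rw [map_smul, smul_eq_mul, mul_comm]
  rfl

lemma conductance_nonneg_or (h : StructCondE ε η) (hf : f ∈ OmegaE ε η) {a b c : Fin 3}
    (hab : a ≠ b) (hac : a ≠ c) (hbc : b ≠ c) :
    0 ≤ conductance ε η f a c b ∨ 0 ≤ conductance ε η f b c a := by
  obtain ⟨hε, hη, hpos, hnn⟩ := h
  have key := condNum_nonneg_or (hε a) (hε b) (hε c) (hpos a b hab) (hpos a c hac) (hpos b c hbc)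
    (hnn a b c hab hac hbc)
    (by have := hnn b a c hab.symm hbc hac; rw [hη b a] at this; exact this)
    (by have := hnn c a b hac.symm hbc.symm hab; rw [hη c a, hη c b] at this; exact this)
    (exp_pos (f a)) (exp_pos (f b)) (exp_pos (f c))
  have q0 := sqLen_pos hη hf hac hab hbc.symm
  have r0 := sqLen_pos hη hf hbc hab.symm hac.symm
  unfold conductance
  rw [hη c b, hη b a, hη c a]
  refine key.imp (fun k => ?_) (fun k => ?_) <;> positivity

lemma conductance_pairwise_products_pos (h : StructCondE ε η) (hf : f ∈ OmegaE ε η)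
    {a b c : Fin 3} (hab : a ≠ b) (hac : a ≠ c) (hbc : b ≠ c) :
    0 < conductance ε η f a b c * conductance ε η f a c b
      + conductance ε η f a b c * conductance ε η f b c a
      + conductance ε η f a c b * conductance ε η f b c a := by
  obtain ⟨hε, hη, hpos, hnn⟩ := h
  have hT := structure_form_pos (hε a) (hε b) (hε c) (hpos a b hab) (hpos a c hac) (hpos b c hbc)
    (hnn a b c hab hac hbc)
    (by have := hnn b a c hab.symm hbc hac; rw [hη b a] at this; exact this)
    (by have := hnn c a b hac.symm hbc.symm hab; rw [hη c a, hη c b] at this; exact this)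
    (exp_pos (f a)) (exp_pos (f b)) (exp_pos (f c))
  have hD := heron_lE_pos hη hf hab hac hbc
  have hS : 0 < √(heron (lE ε η f a b) (lE ε η f a c) (lE ε η f b c)) := sqrt_pos.2 hD
  have hsum := four_mul_sum_condNum (ε a) (ε b) (ε c) (η a b) (η a c) (η b c)
    (exp (f a)) (exp (f b)) (exp (f c))
  have hprod := sum_condNum_mul_condNum (ε a) (ε b) (ε c) (η a b) (η a c) (η b c)
    (exp (f a)) (exp (f b)) (exp (f c))
  simp only [← sqLen_eq] at hsum hprod
  have hN : 0 < exp (f a) * exp (f b) * condNum (ε a) (ε b) (η a b) (η a c) (η b c)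
        (exp (f a)) (exp (f b)) (exp (f c))
      + exp (f a) * exp (f c) * condNum (ε a) (ε c) (η a c) (η a b) (η b c)
        (exp (f a)) (exp (f c)) (exp (f b))
      + exp (f b) * exp (f c) * condNum (ε b) (ε c) (η b c) (η a b) (η a c)
        (exp (f b)) (exp (f c)) (exp (f a)) := by
    have hD' := hD
    unfold heron at hD'
    rw [lE_sq hη hf hab hac hbc, lE_sq hη hf hac hab hbc.symm, lE_sq hη hf hbc hab.symm hac.symm,
      ← hsum] at hD'
    linarith
  have hE := mul_pos hN hT
  rw [← hprod] at hE
  have p0 := sqLen_pos hη hf hab hac hbc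
  have q0 := sqLen_pos hη hf hac hab hbc.symm
  have r0 := sqLen_pos hη hf hbc hab.symm hac.symm
  unfold conductance
  rw [heron_lE_swap hη a b c, heron_lE_rotate hη a b c, hη c b, hη b a, hη c a]
  have x0 := exp_pos (f a)
  have y0 := exp_pos (f b)
  have z0 := exp_pos (f c)
  generalize √(heron (lE ε η f a b) (lE ε η f a c) (lE ε η f b c)) = S at *
  generalize sqLen ε η f a b = p at *
  generalize sqLen ε η f a c = q at *
  generalize sqLen ε η f b c = r at *
  generalize exp (f a) = x at *
  generalize exp (f b) = y at *
  generalize exp (f c) = z at *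
  have hfac := mul_pos (show 0 < 4 * (x * y * z) / (p * q * r * S ^ 2) by positivity) hE
  refine hfac.trans_eq ?_
  field_simp
  ring

end Triangle

/-- Under the structure conditions, the angle map is smooth on the
admissible space, and at every admissible point its Jacobian `Λ^E_{ijk} = (∂θ_a/∂u_b)`
is symmetric, negative semidefinite, has kernel exactly `{c(1,1,1)ᵀ : c ∈ ℝ}`, and
in particular has rank `2`. -/
theorem euclidean_angle_jacobian (ε : Fin 3 → ℝ) (η : Fin 3 → Fin 3 → ℝ)
    (hstruct : StructCondE ε η) :
    ContDiffOn ℝ (⊤ : ℕ∞) (fun f : Fin 3 → ℝ => fun a => thetaE ε η f a) (OmegaE ε η) ∧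
    ∀ f ∈ OmegaE ε η,
      (∀ a b, JacE ε η f a b = JacE ε η f b a) ∧
      (∀ v : Fin 3 → ℝ, ∑ a, ∑ b, v a * JacE ε η f a b * v b ≤ 0) ∧
      (∀ v : Fin 3 → ℝ, ((∀ a, ∑ b, JacE ε η f a b * v b = 0) ↔ ∃ c : ℝ, v = fun _ => c)) ∧
      (Matrix.of fun a b => JacE ε η f a b).rank = 2 := by
  have hη := hstruct.2.1
  refine ⟨contDiffOn_pi.2 fun a f hf => (contDiffAt_thetaE hη hf a).contDiffWithinAt,
    fun f hf => ?_⟩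
  have h01 : (0 : Fin 3) ≠ 1 := by decide
  have h02 : (0 : Fin 3) ≠ 2 := by decide
  have h12 : (1 : Fin 3) ≠ 2 := by decide
  have hprod := conductance_pairwise_products_pos hstruct hf h01 h02 h12
  have hadd := add_pos_of_pairwise_products hprod
    (by
      have := conductance_nonneg_or hstruct hf h12 h01.symm h02.symm
      rwa [conductance_comm hη 1 0, conductance_comm hη 2 0] at this)
    (by
      have := conductance_nonneg_or hstruct hf h02 h01 h12.symm
      rwa [conductance_comm hη 2 1] at this)
    (conductance_nonneg_or hstruct hf h01 h02 h12)
  have hJ0 : ∀ v, fderiv ℝ (fun g => thetaE ε η g 0) f v =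
      conductance ε η f 0 1 2 * (v 1 - v 0) + conductance ε η f 0 2 1 * (v 2 - v 0) :=
    fderiv_thetaE hη hf 0
  have hJ1 : ∀ v, fderiv ℝ (fun g => thetaE ε η g 1) f v =
      conductance ε η f 1 2 0 * (v 2 - v 1) + conductance ε η f 0 1 2 * (v 0 - v 1) := by
    rw [conductance_comm hη 0 1]
    exact fderiv_thetaE hη hf 1
  have hJ2 : ∀ v, fderiv ℝ (fun g => thetaE ε η g 2) f v =
      conductance ε η f 0 2 1 * (v 0 - v 2) + conductance ε η f 1 2 0 * (v 1 - v 2) := by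
    rw [conductance_comm hη 0 2, conductance_comm hη 1 2]
    exact fderiv_thetaE hη hf 2
  generalize conductance ε η f 0 1 2 = u at *
  generalize conductance ε η f 0 2 1 = v at *
  generalize conductance ε η f 1 2 0 = w at *
  have hform : ∀ x : Fin 3 → ℝ, ∑ a, x a * ∑ b, JacE ε η f a b * x b =
      -(u * (x 0 - x 1) ^ 2 + v * (x 0 - x 2) ^ 2 + w * (x 1 - x 2) ^ 2) := by
    intro x
    simp only [sum_JacE_mul]
    simp only [Fin.sum_univ_three, hJ0, hJ1, hJ2]
    ring
  have hker : ∀ x : Fin 3 → ℝ,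
      (∀ a, ∑ b, JacE ε η f a b * x b = 0) ↔ ∃ c : ℝ, x = fun _ => c := by
    intro x
    constructor
    · intro hx
      have h0 := hform x
      simp only [hx, mul_zero, Finset.sum_const_zero] at h0
      obtain ⟨h₁, h₂⟩ := (graph_form_nonneg_and_eq_zero hprod hadd (x 0) (x 1) (x 2)).2
        (by linarith)
      refine ⟨x 2, funext fun a => ?_⟩
      fin_cases a
      exacts [h₁, h₂, rfl]
    · rintro ⟨c, rfl⟩ a
      rw [sum_JacE_mul]
      fin_cases a
      · simpa using hJ0 fun _ => c
      · simpa using hJ1 fun _ => c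
      · simpa using hJ2 fun _ => c
  refine ⟨?_, fun x => ?_, hker, ?_⟩
  · intro a b
    fin_cases a <;> fin_cases b <;> simp [JacE, hJ0, hJ1, hJ2]
  · simp only [mul_assoc, ← Finset.mul_sum]
    rw [hform]
    linarith [(graph_form_nonneg_and_eq_zero hprod hadd (x 0) (x 1) (x 2)).1]
  · have hspan : LinearMap.ker (Matrix.of fun a b => JacE ε η f a b).mulVecLin =
        Submodule.span ℝ {(fun _ => 1 : Fin 3 → ℝ)} := by
      ext x
      rw [LinearMap.mem_ker, Submodule.mem_span_singleton, funext_iff]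
      refine (hker x).trans (exists_congr fun c => ?_)
      simp only [funext_iff, Pi.smul_apply, smul_eq_mul, mul_one, eq_comm]
    have hrank := LinearMap.finrank_range_add_finrank_ker
      (Matrix.of fun a b => JacE ε η f a b).mulVecLin
    rw [hspan, finrank_span_singleton (fun h => one_ne_zero (congrFun h 0)),
      Module.finrank_fin_fun] at hrank
    unfold Matrix.rank
    omega
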